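/- For every rational r∈[0,1] and all positive-normal-form PoCTL state formulae Φ and Ψ, the formula (Po_{≥r}(◯Φ)∧Ne_{>1−r}(◯Ψ))→Po_{≥r}(◯(Φ∧Ψ)) is a theorem of AxSys_PoCTL: ⊢ (Po_{≥r}(◯Φ)∧Ne_{>1−r}(◯Ψ))→Po_{≥r}(◯(Φ∧Ψ)). -/

import Mathlib

open Set

/-- An interval `J ⊆ [0,1]` with rational bounds. -/
inductive RatInterval : Type where
  | icc (u v : ℚ)
  | ioc (u v : ℚ)
  | ico (u v : ℚ)
  | ioo (u v : ℚ)
  deriving DecidableEq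

/-- Membership of a real number in a rational-bounded interval. -/
def RatInterval.mem : RatInterval → ℝ → Prop
  | .icc u v, x => (u : ℝ) ≤ x ∧ x ≤ (v : ℝ)
  | .ioc u v, x => (u : ℝ) < x ∧ x ≤ (v : ℝ)
  | .ico u v, x => (u : ℝ) ≤ x ∧ x < (v : ℝ)
  | .ioo u v, x => (u : ℝ) < x ∧ x < (v : ℝ)

mutual
/-- PoCTL state formulae (including the derived connective `∨`, the necessity
operator `Ne_J`, and in path formulae the operators `𝐑`, `◇`). -/
inductive SF (A : Type) : Type where
  | tt : SF A
  | atom : A → SF A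
  | and : SF A → SF A → SF A
  | or : SF A → SF A → SF A
  | not : SF A → SF A
  | po : RatInterval → PF A → SF A
  | ne : RatInterval → PF A → SF A

/-- PoCTL path formulae. -/
inductive PF (A : Type) : Type where
  | next : SF A → PF A
  | untl : SF A → SF A → PF A
  | buntl : ℕ → SF A → SF A → PF A
  | rel : SF A → SF A → PF A
  | ev : SF A → PF A
  | box : SF A → PF A
end

/-- `Po_{≥r}(φ)`. -/
def poGe {A : Type} (r : ℚ) (φ : PF A) : SF A := .po (.icc r 1) φ
/-- `Po_{>r}(φ)`. -/
def poGt {A : Type} (r : ℚ) (φ : PF A) : SF A := .po (.ioc r 1) φ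
/-- `Po_{≤r}(φ)`. -/
def poLe {A : Type} (r : ℚ) (φ : PF A) : SF A := .po (.icc 0 r) φ
/-- `Po_{<r}(φ)`. -/
def poLt {A : Type} (r : ℚ) (φ : PF A) : SF A := .po (.ico 0 r) φ
/-- `Ne_{≥r}(φ)`. -/
def neGe {A : Type} (r : ℚ) (φ : PF A) : SF A := .ne (.icc r 1) φ
/-- `Ne_{>r}(φ)`. -/
def neGt {A : Type} (r : ℚ) (φ : PF A) : SF A := .ne (.ioc r 1) φ
/-- `Ne_{≤r}(φ)`. -/
def neLe {A : Type} (r : ℚ) (φ : PF A) : SF A := .ne (.icc 0 r) φ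
/-- `Ne_{<r}(φ)`. -/
def neLt {A : Type} (r : ℚ) (φ : PF A) : SF A := .ne (.ico 0 r) φ
/-- The interval is a lower threshold `[r,1]` (`Po_{≥r}`) or `(r,1]` (`Po_{>r}`)
with `r` a rational in `[0,1]`, as used in positive normal form. -/
def RatInterval.isThreshold : RatInterval → Prop := fun J =>
  ∃ r : ℚ, 0 ≤ r ∧ r ≤ 1 ∧ (J = .icc r 1 ∨ J = .ioc r 1)

mutual
/-- The state formula contains no bounded-until operator `⊔^{≤n}`. -/
def SF.noBUntl {A : Type} : SF A → Prop
  | .tt => True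
  | .atom _ => True
  | .and Φ Ψ => Φ.noBUntl ∧ Ψ.noBUntl
  | .or Φ Ψ => Φ.noBUntl ∧ Ψ.noBUntl
  | .not Φ => Φ.noBUntl
  | .po _ φ => φ.noBUntl
  | .ne _ φ => φ.noBUntl

/-- The path formula contains no bounded-until operator `⊔^{≤n}`. -/
def PF.noBUntl {A : Type} : PF A → Prop
  | .next Φ => Φ.noBUntl
  | .untl Φ Ψ => Φ.noBUntl ∧ Ψ.noBUntl
  | .buntl _ _ _ => False
  | .rel Φ Ψ => Φ.noBUntl ∧ Ψ.noBUntl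
  | .ev Φ => Φ.noBUntl
  | .box Φ => Φ.noBUntl
end

mutual
/-- The state formula is in positive normal form: it is built by
`Φ ::= true | p | ¬Φ | Φ₁∧Φ₂ | Φ₁∨Φ₂ | Po_{∼r}(φ) | Ne_{∼r}(φ)` with `∼ ∈ {≥,>}`,
`r` a rational in `[0,1]`, and path formulae `φ ::= ◯Φ | Φ₁⊔Φ₂ | Φ₁𝐑Φ₂ | ◇Φ | □Φ`. -/
def SF.isPNF {A : Type} : SF A → Prop
  | .tt => True
  | .atom _ => True
  | .and Φ Ψ => Φ.isPNF ∧ Ψ.isPNF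
  | .or Φ Ψ => Φ.isPNF ∧ Ψ.isPNF
  | .not Φ => Φ.isPNF
  | .po J φ => J.isThreshold ∧ φ.isPNF
  | .ne J φ => J.isThreshold ∧ φ.isPNF

/-- The path formula is in positive normal form. -/
def PF.isPNF {A : Type} : PF A → Prop
  | .next Φ => Φ.isPNF
  | .untl Φ Ψ => Φ.isPNF ∧ Ψ.isPNF
  | .buntl _ _ _ => False
  | .rel Φ Ψ => Φ.isPNF ∧ Ψ.isPNF
  | .ev Φ => Φ.isPNF
  | .box Φ => Φ.isPNF
end

mutual
/-- The length (number of symbols) of a state formula. -/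
def SF.size {A : Type} : SF A → ℕ
  | .tt => 1
  | .atom _ => 1
  | .and Φ Ψ => Φ.size + Ψ.size + 1
  | .or Φ Ψ => Φ.size + Ψ.size + 1
  | .not Φ => Φ.size + 1
  | .po _ φ => φ.size + 1
  | .ne _ φ => φ.size + 1

/-- The length (number of symbols) of a path formula. -/
def PF.size {A : Type} : PF A → ℕ
  | .next Φ => Φ.size + 1
  | .untl Φ Ψ => Φ.size + Ψ.size + 1
  | .buntl _ Φ Ψ => Φ.size + Ψ.size + 1
  | .rel Φ Ψ => Φ.size + Ψ.size + 1
  | .ev Φ => Φ.size + 1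
  | .box Φ => Φ.size + 1
end
/-- Derived implication `Φ → Ψ := ¬Φ ∨ Ψ`. -/
def SF.imp {A : Type} (Φ Ψ : SF A) : SF A := .or (.not Φ) Ψ

/-- Derived equivalence `Φ ↔ Ψ := (Φ → Ψ) ∧ (Ψ → Φ)`. -/
def SF.iff {A : Type} (Φ Ψ : SF A) : SF A := .and (Φ.imp Ψ) (Ψ.imp Φ)

/-- The threshold interval for the comparison `∼ ∈ {≥, >}` (encoded as a Boolean:
`true` for `≥`, `false` for `>`): `[r,1]` for `≥` and `(r,1]` for `>`. -/
def thInt (b : Bool) (r : ℚ) : RatInterval := if b then .icc r 1 else .ioc r 1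

/-- `Po_{∼r}(φ)` with `∼ = ≥` if `b = true` and `∼ = >` if `b = false`. -/
def Pos {A : Type} (b : Bool) (r : ℚ) (φ : PF A) : SF A := .po (thInt b r) φ

/-- `Ne_{∼r}(φ)` with `∼ = ≥` if `b = true` and `∼ = >` if `b = false`. -/
def Nes {A : Type} (b : Bool) (r : ℚ) (φ : PF A) : SF A := .ne (thInt b r) φ

/-- `v` is a Boolean valuation of state formulae respecting the propositional
connectives (treating `true`, `∧`, `∨`, `¬` truth-functionally). -/
def BoolVal {A : Type} (v : SF A → Bool) : Prop :=
  v SF.tt = true ∧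
  (∀ Φ Ψ : SF A, v (SF.and Φ Ψ) = (v Φ && v Ψ)) ∧
  (∀ Φ Ψ : SF A, v (SF.or Φ Ψ) = (v Φ || v Ψ)) ∧
  (∀ Φ : SF A, v (SF.not Φ) = !v Φ)

/-- `Φ` is an instance of a classical propositional tautology: it evaluates to `true`
under every Boolean valuation respecting the propositional connectives. -/
def IsTaut {A : Type} (Φ : SF A) : Prop := ∀ v : SF A → Bool, BoolVal v → v Φ = true

/-- Theoremhood in the axiomatic system `AxSys_PoCTL`: axiom schemes (A1)–(A11),
(AP1)–(AP3) and inference rules (R1) modus ponens and (R2) necessitation. -/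
inductive Thm {A : Type} : SF A → Prop
  | a1 {Φ : SF A} : IsTaut Φ → Thm Φ
  | a2 (b : Bool) (r : ℚ) (h0 : 0 ≤ r) (h1 : r ≤ 1) (Φ Ψ : SF A) :
      Thm ((Pos b r (.next (.or Φ Ψ))).iff (.or (Pos b r (.next Φ)) (Pos b r (.next Ψ))))
  | a3a (b : Bool) (r : ℚ) (h0 : 0 ≤ r) (h1 : r ≤ 1) (Φ : SF A) :
      Thm ((Pos b r (.ev Φ)).iff (Pos b r (.untl .tt Φ)))
  | a3b (b : Bool) (r : ℚ) (h0 : 0 ≤ r) (h1 : r ≤ 1) (Φ : SF A) :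
      Thm ((Nes b r (.ev Φ)).iff (Nes b r (.untl .tt Φ)))
  | a4a (b : Bool) (r : ℚ) (h0 : 0 ≤ r) (h1 : r ≤ 1) (Φ : SF A) :
      Thm ((Pos b r (.box Φ)).iff (.not (Nes (!b) (1 - r) (.ev (.not Φ)))))
  | a4b (b : Bool) (r : ℚ) (h0 : 0 ≤ r) (h1 : r ≤ 1) (Φ : SF A) :
      Thm ((Nes b r (.box Φ)).iff (.not (Pos (!b) (1 - r) (.ev (.not Φ)))))
  | a5 (b : Bool) (r : ℚ) (h0 : 0 ≤ r) (h1 : r ≤ 1) (Φ : SF A) :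
      Thm ((Nes b r (.next Φ)).iff (.not (Pos (!b) (1 - r) (.next (.not Φ)))))
  | a6 (b : Bool) (r : ℚ) (h0 : 0 ≤ r) (h1 : r ≤ 1) (Φ Ψ : SF A) :
      Thm ((SF.or Ψ (.and Φ (Pos b r (.next (Pos b r (.untl Φ Ψ)))))).imp
        (Pos b r (.untl Φ Ψ)))
  | a7 (b : Bool) (r : ℚ) (h0 : 0 ≤ r) (h1 : r ≤ 1) (Φ Ψ : SF A) :
      Thm ((SF.or Ψ (.and Φ (Nes b r (.next (Nes b r (.untl Φ Ψ)))))).imp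
        (Nes b r (.untl Φ Ψ)))
  | a8 (b : Bool) (r : ℚ) (h0 : 0 ≤ r) (h1 : r < 1) :
      Thm (Pos b r (PF.next (A := A) .tt))
  | a9 (b : Bool) (r : ℚ) (h0 : 0 ≤ r) (h1 : r ≤ 1) (Φ Ψ Ξ : SF A) :
      Thm ((Nes b r (.box ((SF.or Ψ (.and Φ (Nes b r (.next Ξ)))).imp Ξ))).imp
        ((Nes b r (.untl Φ Ψ)).imp Ξ))
  | a10 (b : Bool) (r : ℚ) (h0 : 0 ≤ r) (h1 : r ≤ 1) (Φ Ψ Ξ : SF A) :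
      Thm ((Nes b r (.box ((SF.or Ψ (.and Φ (Pos (!b) (1 - r) (.next Ξ)))).imp Ξ))).imp
        ((Pos (!b) (1 - r) (.untl Φ Ψ)).imp Ξ))
  | a11 (b : Bool) (r : ℚ) (h0 : 0 ≤ r) (h1 : r ≤ 1) (Φ Ψ : SF A) :
      Thm ((Nes b r (.box (Φ.imp Ψ))).imp
        ((Pos (!b) (1 - r) (.next Φ)).imp (Pos (!b) (1 - r) (.next Ψ))))
  | ap1 (r : ℚ) (h0 : 0 ≤ r) (h1 : r ≤ 1) (φ : PF A) :
      Thm ((Pos false r φ).imp (Pos true r φ))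
  | ap2 (r₁ r₂ : ℚ) (h0 : 0 ≤ r₂) (h : r₂ < r₁) (h1 : r₁ ≤ 1) (φ : PF A) :
      Thm ((Pos true r₁ φ).imp (Pos false r₂ φ))
  | ap3 (r₁ r₂ : ℚ) (h0 : 0 ≤ r₂) (h : r₂ ≤ r₁) (h1 : r₁ ≤ 1) (φ : PF A) :
      Thm ((Pos true r₁ φ).imp (Pos true r₂ φ))
  | mp {Φ Ψ : SF A} : Thm (Φ.imp Ψ) → Thm Φ → Thm Ψ
  | nec1 (b : Bool) (r : ℚ) (h0 : 0 ≤ r) (h1 : r ≤ 1) {Φ : SF A} :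
      Thm Φ → Thm (Nes b r (.next Φ))
  | nec2 (b : Bool) (r : ℚ) (h0 : 0 ≤ r) (h1 : r ≤ 1) {Φ : SF A} :
      Thm Φ → Thm (Nes b r (.box Φ))

/-- `Γ ⊢ Φ`: `Φ` is deducible from the set of assumptions `Γ` in `AxSys_PoCTL`
(necessitation may be applied only to theorems, not to the assumptions). -/
inductive Deduc {A : Type} (Γ : Set (SF A)) : SF A → Prop
  | thm {Φ : SF A} : Thm Φ → Deduc Γ Φ
  | hyp {Φ : SF A} : Φ ∈ Γ → Deduc Γ Φ
  | mp {Φ Ψ : SF A} : Deduc Γ (Φ.imp Ψ) → Deduc Γ Φ → Deduc Γ Ψ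
/-- If `Φ → Ψ` is a theorem, then so is `Po_{∼r}(◯Φ) → Po_{∼r}(◯Ψ)`. -/
theorem Thm.pos_next_mono {A : Type} (b : Bool) (r : ℚ) (h0 : 0 ≤ r) (h1 : r ≤ 1)
    {Φ Ψ : SF A} (h : Thm (Φ.imp Ψ)) :
    Thm ((Pos b r (.next Φ)).imp (Pos b r (.next Ψ))) := by
  have hbox := Thm.nec2 (!b) (1 - r) (by linarith) (by linarith) h
  simpa using (Thm.a11 (!b) (1 - r) (by linarith) (by linarith) Φ Ψ).mp hbox

/-- **Lemma.** For every rational `r ∈ [0,1]` and all positive-normal-form state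
formulae `Φ, Ψ`: `⊢ (Po_{≥r}(◯Φ) ∧ Ne_{>1−r}(◯Ψ)) → Po_{≥r}(◯(Φ∧Ψ))`. -/
theorem thm_poGe_and_neGt_next {A : Type} (r : ℚ) (h0 : 0 ≤ r) (h1 : r ≤ 1)
    (Φ Ψ : SF A) (hΦ : Φ.isPNF) (hΨ : Ψ.isPNF) :
    Thm ((SF.and (Pos true r (.next Φ)) (Nes false (1 - r) (.next Ψ))).imp
      (Pos true r (.next (.and Φ Ψ)))) := by
  have split : Thm (Φ.imp (.or (.and Φ Ψ) (.not Ψ))) := .a1 fun v ⟨_, hand, hor, hnot⟩ => by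
    simp only [SF.imp, hand, hor, hnot]
    cases v Φ <;> cases v Ψ <;> rfl
  have mono := split.pos_next_mono true r h0 h1
  have dist := Thm.a2 true r h0 h1 (.and Φ Ψ) (.not Ψ)
  have dual := Thm.a5 false (1 - r) (by linarith) (by linarith) Ψ
  rw [sub_sub_cancel, Bool.not_false] at dual
  refine Thm.mp (.mp (.mp (.a1 fun v ⟨_, hand, hor, hnot⟩ => ?_) mono) dist) dual
  simp only [SF.imp, SF.iff, hand, hor, hnot]
  generalize v (Pos true r (.next Φ)) = a
  generalize v (Pos true r (.next (.or (.and Φ Ψ) (.not Ψ)))) = b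
  generalize v (Pos true r (.next (.and Φ Ψ))) = c
  generalize v (Pos true r (.next (.not Ψ))) = d
  generalize v (Nes false (1 - r) (.next Ψ)) = e
  revert a b c d e
  decide
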